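/- Let m and n be positive integers. Every finite group expressible as a product of a cyclic subgroup of order m and a cyclic subgroup of order n is abelian if and only if gcd(m, φ(n)) = gcd(n, φ(m)) = 1. -/

import Mathlib

open MulAction
open scoped commutatorElement

theorem conj_mul_inv_mem_of_coprime {G : Type*} [Group G] {p n r : ℕ} (hp : p.Prime) (hn : 0 < n)
    (hcop : n.Coprime (p - 1)) {b x w : G} {W : Subgroup G} (hb : b ^ n = 1) (hx : x ^ p = 1)
    (hxW : x ∉ W) (hWb : ∀ u ∈ W, Commute b u) (hWx : ∀ u ∈ W, Commute x u) (hw : w ∈ W)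
    (h : b * x * b⁻¹ = x ^ r * w) : b * x * b⁻¹ * x⁻¹ ∈ W := by
  have : Fact p.Prime := ⟨hp⟩
  have key : ∀ k : ℕ, ∃ u ∈ W, b ^ k * x * (b ^ k)⁻¹ = x ^ (r ^ k) * u := by
    intro k
    induction k with
    | zero => exact ⟨1, W.one_mem, by simp⟩
    | succ k ih =>
      obtain ⟨u, hu, hk⟩ := ih
      refine ⟨w ^ (r ^ k) * u, W.mul_mem (W.pow_mem hw _) hu, ?_⟩
      calc b ^ (k + 1) * x * (b ^ (k + 1))⁻¹ = b * (b ^ k * x * (b ^ k)⁻¹) * b⁻¹ := by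
            rw [pow_succ']; group
        _ = (b * x * b⁻¹) ^ (r ^ k) * (b * u * b⁻¹) := by
            rw [hk, conj_pow]; group
        _ = x ^ (r ^ (k + 1)) * (w ^ (r ^ k) * u) := by
            rw [h, ((hWx w hw).pow_left r).mul_pow, (hWb u hu).eq, mul_inv_cancel_right,
              ← pow_mul, ← pow_succ', mul_assoc]
  obtain ⟨u, hu, hk⟩ := key n
  have hmem : x ^ ((r : ℤ) ^ n - 1) ∈ W := by
    have : x ^ ((r : ℤ) ^ n - 1) = u⁻¹ := by
      rw [hb, one_mul, inv_one, mul_one] at hk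
      rw [zpow_sub, zpow_one, ← Nat.cast_pow, zpow_natCast, mul_inv_eq_iff_eq_mul,
        ← ((hWx u hu).inv_right).eq, eq_mul_inv_iff_mul_eq, ← hk]
    rw [this]
    exact W.inv_mem hu
  have hdvd : (p : ℤ) ∣ (r : ℤ) ^ n - 1 := by
    by_contra hnd
    have hc : IsCoprime (p : ℤ) ((r : ℤ) ^ n - 1) :=
      ((Nat.prime_iff_prime_int.mp hp).coprime_iff_not_dvd).mpr hnd
    obtain ⟨s, t, hst⟩ := hc
    apply hxW
    have : x = (x ^ ((r : ℤ) ^ n - 1)) ^ t := by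
      rw [← zpow_mul, mul_comm]
      have h1 : x ^ (s * (p : ℤ)) = 1 := by
        rw [mul_comm, zpow_mul, zpow_natCast, hx, one_zpow]
      calc x = x ^ (s * (p : ℤ) + t * ((r : ℤ) ^ n - 1)) := by rw [hst, zpow_one]
        _ = _ := by rw [zpow_add, h1, one_mul]
    rw [this]
    exact W.zpow_mem hmem t
  have hrn : (r : ZMod p) ^ n = 1 := by
    have := (ZMod.intCast_zmod_eq_zero_iff_dvd _ _).mpr hdvd
    push_cast at this
    exact sub_eq_zero.mp this
  have hr0 : (r : ZMod p) ≠ 0 := by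
    intro h0
    rw [h0, zero_pow hn.ne'] at hrn
    exact zero_ne_one hrn
  have hr1 : (r : ZMod p) = 1 := by
    have := pow_gcd_eq_one.mpr ⟨hrn, ZMod.pow_card_sub_one_eq_one hr0⟩
    rwa [hcop, pow_one] at this
  have hxr : x ^ r = x := by
    have : r ≡ 1 [MOD p] := (ZMod.natCast_eq_natCast_iff _ _ _).mp (by simpa using hr1)
    conv_rhs => rw [← pow_one x]
    exact pow_eq_pow_iff_modEq.mpr (this.of_dvd (orderOf_dvd_of_pow_eq_one hx))
  rw [h, hxr, (hWx w hw).eq, mul_inv_cancel_right]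
  exact hw

theorem commute_of_mem_normal_of_card_prime {G : Type*} [Group G] [Finite G] {p : ℕ}
    (hp : p.Prime) {V : Subgroup G} [V.Normal] (hV : Nat.card V = p) {c x : G}
    (hc : (orderOf c).Coprime (p - 1)) (hx : x ∈ V) : Commute c x := by
  have : Fact p.Prime := ⟨hp⟩
  by_cases hx1 : x = 1
  · rw [hx1]; exact Commute.one_right c
  have hpow : x ^ p = 1 := by
    have := pow_card_eq_one' (x := (⟨x, hx⟩ : V))
    rw [hV] at this
    simpa using congrArg Subtype.val this
  have hmem : c * x * c⁻¹ ∈ V := ‹V.Normal›.conj_mem x hx c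
  have hz := mem_powers_of_prime_card (g := (⟨x, hx⟩ : V)) (g' := ⟨c * x * c⁻¹, hmem⟩) hV
    (by simpa [Subtype.ext_iff] using hx1)
  obtain ⟨r, hr⟩ := hz
  have hr' : c * x * c⁻¹ = x ^ r * 1 := by
    simpa using (congrArg Subtype.val hr).symm
  have := conj_mul_inv_mem_of_coprime hp (orderOf_pos c) hc (W := ⊥) (pow_orderOf_eq_one c) hpow
    (by simpa using hx1) (by simp) (by simp) (Subgroup.mem_bot.mpr rfl) hr'
  rw [Subgroup.mem_bot, mul_inv_eq_one, mul_inv_eq_iff_eq_mul] at this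
  exact this

theorem index_dvd_card_of_forall_eq_mul {G : Type*} [Group G] [Finite G] {A B : Subgroup G}
    (h : ∀ g : G, ∃ y ∈ B, ∃ x ∈ A, g = y * x) : A.index ∣ Nat.card B := by
  have : IsPretransitive B (G ⧸ A) := by
    rw [isPretransitive_iff_base (QuotientGroup.mk 1 : G ⧸ A)]
    intro q
    induction q using QuotientGroup.induction_on with
    | H g =>
      obtain ⟨y, hy, x, hx, rfl⟩ := h g
      refine ⟨⟨y, hy⟩, ?_⟩
      change QuotientGroup.mk (y * 1) = (QuotientGroup.mk (y * x) : G ⧸ A)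
      rw [QuotientGroup.eq]
      simpa using hx
  rw [Subgroup.index, ← index_stabilizer_of_transitive B (QuotientGroup.mk 1 : G ⧸ A)]
  exact Subgroup.index_dvd_card _

theorem relIndex_dvd_index_of_right_normal {G : Type*} [Group G] [Finite G] (A V : Subgroup G)
    [V.Normal] : A.relIndex V ∣ A.index := by
  have h1 := Subgroup.relIndex_sup_right A V
  have h2 := Subgroup.relIndex_mul_relIndex (⊥ : Subgroup G) A (A ⊔ V) bot_le le_sup_left
  have h3 := Subgroup.relIndex_mul_relIndex (⊥ : Subgroup G) V (A ⊔ V) bot_le le_sup_right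
  have h4 := Subgroup.relIndex_mul_relIndex (⊥ : Subgroup G) (A ⊓ V) V bot_le inf_le_right
  have h5 := Subgroup.relIndex_mul_relIndex (⊥ : Subgroup G) (A ⊓ V) A bot_le inf_le_left
  rw [Subgroup.inf_relIndex_right] at h4
  rw [Subgroup.inf_relIndex_left] at h5
  simp only [Subgroup.relIndex_bot_left] at h2 h3 h4 h5
  have h6 : A.relIndex (A ⊔ V) = A.relIndex V := by
    apply Nat.eq_of_mul_eq_mul_left (Nat.card_pos (α := A))
    rw [h2, ← h3, h1, ← h4, ← h5]
    ring
  rw [← h6]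
  exact Subgroup.relIndex_dvd_index_of_le le_sup_left

theorem sub_one_dvd_totient {p n : ℕ} (hp : p.Prime) (h : p ∣ n) : p - 1 ∣ n.totient := by
  rw [← Nat.totient_prime hp]
  exact Nat.totient_dvd_of_dvd h

theorem not_sq_dvd_of_coprime_totient {p m n : ℕ} (hp : p.Prime) (h : m.Coprime n.totient)
    (hm : p ∣ m) : ¬ p ^ 2 ∣ n := by
  intro hn
  have h1 : p ∣ (p ^ 2).totient := by
    rw [Nat.totient_prime_pow hp two_pos]
    simp
  exact Nat.Prime.not_coprime_iff_dvd.mpr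
    ⟨p, hp, hm, h1.trans (Nat.totient_dvd_of_dvd hn)⟩ h

theorem exists_ne_one_commute_of_le_zpowers {G : Type*} [Group G] [Finite G] {p : ℕ}
    (hp : p.Prime) {a b : G} {V : Subgroup G} [V.Normal] (hVp : ∀ x ∈ V, x ^ p = 1) (hV : V ≠ ⊥)
    (hab : (orderOf a).Coprime (orderOf b).totient) (hVb : V ≤ Subgroup.zpowers b) :
    ∃ x, x ≠ 1 ∧ Commute a x ∧ Commute b x := by
  have : IsCyclic V := Subgroup.isCyclic_of_le hVb
  have hcard : Nat.card V = p := by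
    obtain ⟨g, hg⟩ := IsCyclic.exists_generator (α := V)
    rw [← orderOf_eq_card_of_forall_mem_zpowers hg]
    have hd : orderOf g ∣ p := orderOf_dvd_of_pow_eq_one (Subtype.ext (hVp g g.2))
    refine (hp.eq_one_or_self_of_dvd _ hd).resolve_left fun h1 => hV ?_
    rw [orderOf_eq_card_of_forall_mem_zpowers hg] at h1
    exact Subgroup.card_eq_one.mp h1
  have hpb : p ∣ orderOf b := by
    rw [← hcard, ← Nat.card_zpowers]
    exact Subgroup.card_dvd_of_le hVb
  obtain ⟨x, hx, hx1⟩ := V.bot_or_exists_ne_one.resolve_left hV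
  refine ⟨x, hx1, commute_of_mem_normal_of_card_prime hp hcard
    (hab.coprime_dvd_right (sub_one_dvd_totient hp hpb)) hx, ?_⟩
  obtain ⟨k, rfl⟩ := Subgroup.mem_zpowers_iff.mp (hVb hx)
  exact Commute.self_zpow b k

theorem commute_of_relIndex_zpowers_prime {G : Type*} [Group G] [Finite G] {p : ℕ}
    (hp : p.Prime) {b x y : G} {V : Subgroup G} [V.Normal]
    (hVc : ∀ x ∈ V, ∀ y ∈ V, Commute x y) (hVp : ∀ x ∈ V, x ^ p = 1)
    (hb : (orderOf b).Coprime (p - 1)) (hbp : ¬ p ^ 2 ∣ orderOf b)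
    (hidx : (Subgroup.zpowers b).relIndex V = p) (hy : y ∈ Subgroup.zpowers b) (hyV : y ∈ V)
    (hy1 : y ≠ 1) (hx : x ∈ V) : Commute b x := by
  have : Fact p.Prime := ⟨hp⟩
  have hbW : ∀ u ∈ Subgroup.zpowers b, Commute b u := by
    intro u hu
    obtain ⟨k, rfl⟩ := Subgroup.mem_zpowers_iff.mp hu
    exact Commute.self_zpow b k
  by_cases hxb : x ∈ Subgroup.zpowers b
  · exact hbW x hxb
  obtain ⟨r, w, hw, hwV, hr⟩ : ∃ r : ℕ, ∃ w ∈ Subgroup.zpowers b, w ∈ V ∧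
      b * x * b⁻¹ = x ^ r * w := by
    have hmem : b * x * b⁻¹ ∈ V := ‹V.Normal›.conj_mem x hx b
    let N := (Subgroup.zpowers b).subgroupOf V
    have hN : N.Normal := ⟨fun n hn g => by
      rw [show g * n = n * g from Subtype.ext (hVc g g.2 n n.2), mul_inv_cancel_right]
      exact hn⟩
    have hz := mem_powers_of_prime_card (G := V ⧸ N) (g := QuotientGroup.mk ⟨x, hx⟩)
      (g' := QuotientGroup.mk ⟨b * x * b⁻¹, hmem⟩) hidx
      (by rw [Ne, QuotientGroup.eq_one_iff]; exact hxb)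
    obtain ⟨r, hr⟩ := hz
    have hr : (QuotientGroup.mk (⟨x, hx⟩ ^ r) : V ⧸ N) = QuotientGroup.mk ⟨b * x * b⁻¹, hmem⟩ := hr
    rw [QuotientGroup.eq] at hr
    refine ⟨r, (x ^ r)⁻¹ * (b * x * b⁻¹), hr, V.mul_mem (V.inv_mem (V.pow_mem hx r)) hmem, ?_⟩
    rw [mul_inv_cancel_left]
  have hu := conj_mul_inv_mem_of_coprime hp (orderOf_pos b) hb
    (W := Subgroup.zpowers b ⊓ V) (pow_orderOf_eq_one b) (hVp x hx) (fun h => hxb h.1)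
    (fun u hu => hbW u hu.1) (fun u hu => hVc x hx u hu.2) ⟨hw, hwV⟩ hr
  generalize hudef : b * x * b⁻¹ * x⁻¹ = u at hu
  have hbx : b * x * b⁻¹ = u * x := by rw [← hudef, inv_mul_cancel_right]
  have key : ∀ k : ℕ, b ^ k * x * (b ^ k)⁻¹ = u ^ k * x := by
    intro k
    induction k with
    | zero => simp
    | succ k ih =>
      calc b ^ (k + 1) * x * (b ^ (k + 1))⁻¹ = b * (b ^ k * x * (b ^ k)⁻¹) * b⁻¹ := by
            rw [pow_succ']; group
        _ = (b * u ^ k * b⁻¹) * (b * x * b⁻¹) := by rw [ih]; group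
        _ = u ^ (k + 1) * x := by
            rw [((hbW u hu.1).pow_right k).eq, mul_inv_cancel_right, hbx, pow_succ, mul_assoc]
  obtain ⟨j, rfl⟩ := mem_powers_iff_mem_zpowers.mpr hy
  have hyV : b ^ j ∈ V := hyV
  have hy1 : b ^ j ≠ 1 := hy1
  have huj : u ^ j = 1 := by
    have := key j
    rw [(hVc _ hyV x hx).eq, mul_inv_cancel_right] at this
    exact (mul_eq_right.mp this.symm)
  have hpj : ¬ p ∣ j := by
    intro hpj
    have h1 : orderOf b ∣ j * p := by
      apply orderOf_dvd_of_pow_eq_one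
      rw [pow_mul]
      exact hVp _ hyV
    apply hy1
    rw [← orderOf_dvd_iff_pow_eq_one]
    by_cases hpb : p ∣ orderOf b
    · obtain ⟨k, hk⟩ := hpb
      have hpk : p.Coprime k := by
        rw [hp.coprime_iff_not_dvd]
        rintro ⟨l, rfl⟩
        exact hbp ⟨l, by rw [hk]; ring⟩
      rw [hk] at h1 ⊢
      refine hpk.mul_dvd_of_dvd_of_dvd hpj ?_
      exact hpk.symm.dvd_of_dvd_mul_right ((Dvd.intro_left p rfl).trans h1)
    · exact (((hp.coprime_iff_not_dvd).mpr hpb).symm).dvd_of_dvd_mul_right h1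
  have hu1 : u = 1 := by
    have := pow_gcd_eq_one.mpr ⟨huj, hVp u hu.2⟩
    rwa [((hp.coprime_iff_not_dvd).mpr hpj).symm, pow_one] at this
  rw [hu1, one_mul] at hbx
  exact mul_inv_eq_iff_eq_mul.mp hbx

theorem exists_eq_mul_swap {G : Type*} [Group G] {a b : G}
    (hG : ∀ g : G, ∃ i j : ℤ, g = a ^ i * b ^ j) (g : G) : ∃ i j : ℤ, g = b ^ i * a ^ j := by
  obtain ⟨i, j, h⟩ := hG g⁻¹
  refine ⟨-j, -i, ?_⟩
  rw [zpow_neg, zpow_neg, ← mul_inv_rev, ← h, inv_inv]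

theorem index_zpowers_dvd_orderOf {G : Type*} [Group G] [Finite G] {a b : G}
    (hG : ∀ g : G, ∃ i j : ℤ, g = a ^ i * b ^ j) :
    (Subgroup.zpowers b).index ∣ orderOf a := by
  rw [← Nat.card_zpowers]
  refine index_dvd_card_of_forall_eq_mul fun g => ?_
  obtain ⟨i, j, h⟩ := hG g
  exact ⟨a ^ i, ⟨i, rfl⟩, b ^ j, ⟨j, rfl⟩, h⟩

theorem dvd_and_relIndex_zpowers_eq_of_not_le {G : Type*} [Group G] [Finite G] {p : ℕ}
    (hp : p.Prime) {a b : G} (hG : ∀ g : G, ∃ i j : ℤ, g = a ^ i * b ^ j) {V : Subgroup G}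
    [V.Normal] (hVp : ∀ x ∈ V, x ^ p = 1) (hV : ¬ V ≤ Subgroup.zpowers b) :
    p ∣ orderOf a ∧ (¬ p ^ 2 ∣ orderOf a → (Subgroup.zpowers b).relIndex V = p) := by
  have : Fact p.Prime := ⟨hp⟩
  have hpg : IsPGroup p V := fun x => ⟨1, Subtype.ext (by simpa using hVp x x.2)⟩
  obtain ⟨k, hk⟩ := IsPGroup.iff_card.mp hpg
  have hd : (Subgroup.zpowers b).relIndex V ∣ orderOf a :=
    (relIndex_dvd_index_of_right_normal _ V).trans (index_zpowers_dvd_orderOf hG)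
  obtain ⟨l, -, hl⟩ := (Nat.dvd_prime_pow hp).mp (hk ▸ Subgroup.relIndex_dvd_card _ V)
  have hl0 : l ≠ 0 := by
    rintro rfl
    exact hV (Subgroup.relIndex_eq_one.mp hl)
  rw [hl] at hd
  refine ⟨(dvd_pow_self p hl0).trans hd, fun hsq => ?_⟩
  have : l < 2 := by
    by_contra h2
    exact hsq ((pow_dvd_pow p (not_lt.mp h2)).trans hd)
  rw [hl, show l = 1 by omega, pow_one]

theorem exists_ne_one_commute_of_normal {G : Type*} [Group G] [Finite G] {p : ℕ}
    (hp : p.Prime) {a b : G} (hG : ∀ g : G, ∃ i j : ℤ, g = a ^ i * b ^ j)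
    (hab : (orderOf a).Coprime (orderOf b).totient)
    (hba : (orderOf b).Coprime (orderOf a).totient) {V : Subgroup G} [V.Normal]
    (hVc : ∀ x ∈ V, ∀ y ∈ V, Commute x y) (hVp : ∀ x ∈ V, x ^ p = 1) (hV : V ≠ ⊥) :
    ∃ x, x ≠ 1 ∧ Commute a x ∧ Commute b x := by
  by_cases hVb : V ≤ Subgroup.zpowers b
  · exact exists_ne_one_commute_of_le_zpowers hp hVp hV hab hVb
  by_cases hVa : V ≤ Subgroup.zpowers a
  · obtain ⟨x, h1, h2, h3⟩ := exists_ne_one_commute_of_le_zpowers hp hVp hV hba hVa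
    exact ⟨x, h1, h3, h2⟩
  obtain ⟨hpa, hib⟩ := dvd_and_relIndex_zpowers_eq_of_not_le hp hG hVp hVb
  obtain ⟨hpb, hia⟩ := dvd_and_relIndex_zpowers_eq_of_not_le hp (exists_eq_mul_swap hG) hVp hVa
  have hpb2 := not_sq_dvd_of_coprime_totient hp hab hpa
  have hpa2 := not_sq_dvd_of_coprime_totient hp hba hpb
  specialize hib hpa2
  specialize hia hpb2
  have hca := hab.coprime_dvd_right (sub_one_dvd_totient hp hpb)
  have hcb := hba.coprime_dvd_right (sub_one_dvd_totient hp hpa)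
  have of_bot : ∀ c : G, (Subgroup.zpowers c).relIndex V = p → Subgroup.zpowers c ⊓ V = ⊥ →
      ∃ x, x ≠ 1 ∧ Commute a x ∧ Commute b x := by
    intro c hc hbot
    rw [← Subgroup.inf_relIndex_right, hbot, Subgroup.relIndex_bot_left] at hc
    obtain ⟨x, hx, hx1⟩ := V.bot_or_exists_ne_one.resolve_left hV
    exact ⟨x, hx1, commute_of_mem_normal_of_card_prime hp hc hca hx,
      commute_of_mem_normal_of_card_prime hp hc hcb hx⟩
  obtain h | ⟨x, hx, hx1⟩ := (Subgroup.zpowers a ⊓ V).bot_or_exists_ne_one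
  · exact of_bot a hia h
  obtain h | ⟨y, hy, hy1⟩ := (Subgroup.zpowers b ⊓ V).bot_or_exists_ne_one
  · exact of_bot b hib h
  exact ⟨x, hx1, commute_of_relIndex_zpowers_prime hp hVc hVp hca hpa2 hia hx.1 hx.2 hx1 hx.2,
    commute_of_relIndex_zpowers_prime hp hVc hVp hcb hpb2 hib hy.1 hy.2 hy1 hx.2⟩

theorem exists_mul_commutator_zpow_mul_inv {G : Type*} [Group G] {a b : G}
    (hG : ∀ g : G, ∃ i j : ℤ, g = b ^ i * a ^ j) (k j : ℤ) :
    ∃ j' : ℤ, ∀ i : ℤ, a ^ k * ⁅a ^ i, b ^ j⁆ * (a ^ k)⁻¹ = ⁅a ^ i, b ^ j'⁆ := by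
  obtain ⟨s, t, h⟩ := hG (a ^ k * b ^ j * (a ^ k)⁻¹)
  refine ⟨s, fun i => ?_⟩
  have hcomm : a ^ k * a ^ i * (a ^ k)⁻¹ = a ^ i := by group
  have hcomm' : a ^ t * (a ^ i)⁻¹ * (a ^ t)⁻¹ = (a ^ i)⁻¹ := by group
  rw [commutatorElement_def, commutatorElement_def]
  calc _ = (a ^ k * a ^ i * (a ^ k)⁻¹) * (a ^ k * b ^ j * (a ^ k)⁻¹) *
        (a ^ k * a ^ i * (a ^ k)⁻¹)⁻¹ * (a ^ k * b ^ j * (a ^ k)⁻¹)⁻¹ := by group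
    _ = a ^ i * b ^ s * (a ^ t * (a ^ i)⁻¹ * (a ^ t)⁻¹) * (b ^ s)⁻¹ := by
      rw [h, hcomm]; group
    _ = _ := by rw [hcomm']

theorem exists_mul_commutator_zpow_mul_inv' {G : Type*} [Group G] {a b : G}
    (hG : ∀ g : G, ∃ i j : ℤ, g = a ^ i * b ^ j) (k i : ℤ) :
    ∃ i' : ℤ, ∀ j : ℤ, b ^ k * ⁅a ^ i, b ^ j⁆ * (b ^ k)⁻¹ = ⁅a ^ i', b ^ j⁆ := by
  obtain ⟨i', h⟩ := exists_mul_commutator_zpow_mul_inv hG k i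
  refine ⟨i', fun j => ?_⟩
  rw [← commutatorElement_inv (b ^ j) (a ^ i), ← commutatorElement_inv (b ^ j) (a ^ i'), ← h j]
  group

/-- An instance of Itô's theorem: in a product of two cyclic groups, the commutators of elements
of one factor with elements of the other commute with each other. -/
theorem commute_commutator_zpow {G : Type*} [Group G] {a b : G}
    (hG : ∀ g : G, ∃ i j : ℤ, g = a ^ i * b ^ j) (hG' : ∀ g : G, ∃ i j : ℤ, g = b ^ i * a ^ j)
    (k l i j : ℤ) : Commute ⁅a ^ k, b ^ l⁆ ⁅a ^ i, b ^ j⁆ := by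
  obtain ⟨j', hj⟩ := exists_mul_commutator_zpow_mul_inv hG' (-k) j
  obtain ⟨i', hi⟩ := exists_mul_commutator_zpow_mul_inv' hG (-l) i
  have h1 := hj i'
  rw [← hi j] at h1
  have h2 := hi j'
  rw [← hj i, ← h1] at h2
  generalize ⁅a ^ i, b ^ j⁆ = c at h2
  rw [commutatorElement_def]
  refine mul_inv_eq_iff_eq_mul.mp ?_
  simp only [zpow_neg, inv_inv] at h2
  calc _ = a ^ k * b ^ l * ((a ^ k)⁻¹ * ((b ^ l)⁻¹ * c * b ^ l) * a ^ k) * (a ^ k * b ^ l)⁻¹ := by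
        group
    _ = c := by rw [← h2]; group

theorem commute_of_commute_commutator {G : Type*} [Group G] {a b : G}
    (hG : ∀ g : G, ∃ i j : ℤ, g = a ^ i * b ^ j) (ha : Commute a ⁅a, b⁆) (hb : Commute b ⁅a, b⁆)
    (hsq : ∀ p : ℕ, p.Prime → p ∣ orderOf a → p ∣ orderOf b →
      ¬ p ^ 2 ∣ orderOf a ∧ ¬ p ^ 2 ∣ orderOf b) : Commute a b := by
  obtain ⟨i, j, hc⟩ := hG ⁅a, b⁆
  rw [← commutatorElement_eq_one_iff_commute]
  generalize hcdef : ⁅a, b⁆ = c at *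
  have hab : a * b * a⁻¹ = c * b := by rw [← hcdef]; simp [commutatorElement_def]
  have hba : b * a * b⁻¹ = c⁻¹ * a := by
    rw [← hcdef, commutatorElement_inv]; simp [commutatorElement_def]
  have pow_eq_one_of_right : ∀ k : ℤ, Commute a (b ^ k) → c ^ k = 1 := by
    intro k hk
    have := conj_zpow (i := k) (a := a) (b := b)
    rw [hab, hb.symm.mul_zpow, hk.eq, mul_inv_cancel_right] at this
    exact mul_eq_right.mp this
  have pow_eq_one_of_left : ∀ k : ℤ, Commute b (a ^ k) → c ^ k = 1 := by
    intro k hk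
    have := conj_zpow (i := k) (a := b) (b := a)
    rw [hba, ha.symm.inv_left.mul_zpow, hk.eq, mul_inv_cancel_right] at this
    simpa using mul_eq_right.mp this
  have hai : a ^ i = c * (b ^ j)⁻¹ := by rw [hc, mul_inv_cancel_right]
  have hbj : b ^ j = (a ^ i)⁻¹ * c := by rw [hc, inv_mul_cancel_left]
  have hci : c ^ i = 1 := pow_eq_one_of_left i <| by
    rw [hai]; exact hb.mul_right ((Commute.self_zpow b j).inv_right)
  have hcj : c ^ j = 1 := pow_eq_one_of_right j <| by
    rw [hbj]; exact ((Commute.self_zpow a i).inv_right).mul_right ha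
  have hcm : c ^ orderOf a = 1 := by
    simpa using pow_eq_one_of_left (orderOf a) (by simp [pow_orderOf_eq_one])
  have hcn : c ^ orderOf b = 1 := by
    simpa using pow_eq_one_of_right (orderOf b) (by simp [pow_orderOf_eq_one])
  rw [← orderOf_eq_one_iff]
  by_contra hne
  obtain ⟨p, hp, hpc⟩ := Nat.exists_prime_and_dvd hne
  have hpm := hpc.trans (orderOf_dvd_of_pow_eq_one hcm)
  have hpn := hpc.trans (orderOf_dvd_of_pow_eq_one hcn)
  obtain ⟨hm2, hn2⟩ := hsq p hp hpm hpn
  obtain ⟨m', hm'⟩ := hpm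
  obtain ⟨n', hn'⟩ := hpn
  obtain ⟨i', hi'⟩ := (Int.natCast_dvd_natCast.mpr hpc).trans (orderOf_dvd_iff_zpow_eq_one.mpr hci)
  obtain ⟨j', hj'⟩ := (Int.natCast_dvd_natCast.mpr hpc).trans (orderOf_dvd_iff_zpow_eq_one.mpr hcj)
  have h1 : (a ^ i) ^ m' = 1 := by
    rw [← zpow_natCast, ← zpow_mul, ← orderOf_dvd_iff_zpow_eq_one, hm', hi']
    exact ⟨i', by push_cast; ring⟩
  have h2 : (b ^ j) ^ n' = 1 := by
    rw [← zpow_natCast, ← zpow_mul, ← orderOf_dvd_iff_zpow_eq_one, hn', hj']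
    exact ⟨j', by push_cast; ring⟩
  have hcomm : Commute (a ^ i) (b ^ j) := by
    rw [hbj]; exact ((Commute.refl _).inv_right).mul_right (ha.zpow_left i)
  have h3 : c ^ (m' * n') = 1 := by
    rw [hc, hcomm.mul_pow, pow_mul, h1, one_pow, one_mul, mul_comm, pow_mul, h2, one_pow]
  rcases hp.dvd_mul.mp (hpc.trans (orderOf_dvd_of_pow_eq_one h3)) with ⟨l, rfl⟩ | ⟨l, rfl⟩
  · exact hm2 ⟨l, by rw [hm']; ring⟩
  · exact hn2 ⟨l, by rw [hn']; ring⟩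

theorem exists_ne_one_commute_of_not_commute {G : Type*} [Group G] [Finite G] {a b : G}
    (hG : ∀ g : G, ∃ i j : ℤ, g = a ^ i * b ^ j)
    (hab : (orderOf a).Coprime (orderOf b).totient)
    (hba : (orderOf b).Coprime (orderOf a).totient) (h : ¬ Commute a b) :
    ∃ x, x ≠ 1 ∧ Commute a x ∧ Commute b x := by
  have hG' := exists_eq_mul_swap hG
  let S : Set G := {g | ∃ i j : ℤ, g = ⁅a ^ i, b ^ j⁆}
  let K := Subgroup.closure S
  have hSconj : ∀ s ∈ S, ∀ g : G, g * s * g⁻¹ ∈ S := by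
    rintro s ⟨i, j, rfl⟩ g
    obtain ⟨k, l, rfl⟩ := hG g
    obtain ⟨i', hi⟩ := exists_mul_commutator_zpow_mul_inv' hG l i
    obtain ⟨j', hj⟩ := exists_mul_commutator_zpow_mul_inv hG' k j
    refine ⟨i', j', ?_⟩
    rw [← hj i', ← hi j]
    group
  have hKn : K.Normal := ⟨fun s hs g => by
    induction hs using Subgroup.closure_induction with
    | mem s hs => exact Subgroup.subset_closure (hSconj s hs g)
    | one => simp
    | mul s t _ _ hs ht => rw [← conj_mul]; exact K.mul_mem hs ht
    | inv s _ hs => rw [← conj_inv]; exact K.inv_mem hs⟩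
  have hKc : ∀ x ∈ K, ∀ y ∈ K, Commute x y := by
    have : IsMulCommutative K := Subgroup.isMulCommutative_closure <| by
      rintro _ ⟨k, l, rfl⟩ _ ⟨i, j, rfl⟩
      exact (commute_commutator_zpow hG hG' k l i j).eq
    exact fun x hx y hy => setLike_mul_comm hx hy
  have hK1 : Nat.card K ≠ 1 := by
    intro h1
    have hmem : ⁅a, b⁆ ∈ K := Subgroup.subset_closure ⟨1, 1, by simp⟩
    rw [Subgroup.card_eq_one.mp h1, Subgroup.mem_bot, commutatorElement_eq_one_iff_commute] at hmem
    exact h hmem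
  obtain ⟨p, hp, hpK⟩ := Nat.exists_prime_and_dvd hK1
  have : Fact p.Prime := ⟨hp⟩
  obtain ⟨x, hx⟩ := exists_prime_orderOf_dvd_card' p hpK
  let V : Subgroup G :=
    { carrier := {g | g ∈ K ∧ g ^ p = 1}
      one_mem' := ⟨K.one_mem, one_pow p⟩
      mul_mem' := fun {s t} hs ht =>
        ⟨K.mul_mem hs.1 ht.1, by rw [(hKc s hs.1 t ht.1).mul_pow, hs.2, ht.2, one_mul]⟩
      inv_mem' := fun {s} hs => ⟨K.inv_mem hs.1, by rw [inv_pow, hs.2, inv_one]⟩ }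
  have hVn : V.Normal := ⟨fun s hs g => ⟨hKn.conj_mem s hs.1 g, by rw [conj_pow, hs.2]; simp⟩⟩
  refine exists_ne_one_commute_of_normal hp hG hab hba (V := V)
    (fun s hs t ht => hKc s hs.1 t ht.1) (fun s hs => hs.2) fun hV => ?_
  have hxV : (x : G) ∈ V := by
    refine ⟨x.2, ?_⟩
    rw [← hx, ← Subgroup.orderOf_coe, pow_orderOf_eq_one]
  rw [hV, Subgroup.mem_bot, OneMemClass.coe_eq_one] at hxV
  rw [hxV, orderOf_one] at hx
  exact hp.one_lt.ne hx

theorem commute_of_coprime_totient {G : Type*} [Group G] [Finite G] {a b : G}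
    (hG : ∀ g : G, ∃ i j : ℤ, g = a ^ i * b ^ j)
    (hab : (orderOf a).Coprime (orderOf b).totient)
    (hba : (orderOf b).Coprime (orderOf a).totient) : Commute a b := by
  induction hN : Nat.card G using Nat.strong_induction_on generalizing G with
  | _ N ih =>
    by_contra h
    obtain ⟨x, hx1, hax, hbx⟩ := exists_ne_one_commute_of_not_commute hG hab hba h
    have mem_center : ∀ z : G, Commute a z → Commute b z → z ∈ Subgroup.center G := by
      intro z ha hb
      rw [Subgroup.mem_center_iff]
      intro g
      obtain ⟨i, j, rfl⟩ := hG g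
      exact ((ha.zpow_left i).mul_left (hb.zpow_left j)).eq
    have hlt : Nat.card (G ⧸ Subgroup.center G) < N := by
      rw [← hN, Subgroup.card_eq_card_quotient_mul_card_subgroup (Subgroup.center G)]
      refine lt_mul_of_one_lt_right Nat.card_pos ?_
      rw [Subgroup.one_lt_card_iff_ne_bot]
      intro hbot
      exact hx1 (Subgroup.mem_bot.mp (hbot ▸ mem_center x hax hbx))
    have hda := orderOf_map_dvd (QuotientGroup.mk' (Subgroup.center G)) a
    have hdb := orderOf_map_dvd (QuotientGroup.mk' (Subgroup.center G)) b
    have hq := ih _ hlt (a := QuotientGroup.mk' (Subgroup.center G) a)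
      (b := QuotientGroup.mk' (Subgroup.center G) b)
      (fun g => by
        obtain ⟨g, rfl⟩ := QuotientGroup.mk'_surjective _ g
        obtain ⟨i, j, rfl⟩ := hG g
        exact ⟨i, j, by simp only [map_mul, map_zpow]⟩)
      ((hab.coprime_dvd_left hda).coprime_dvd_right (Nat.totient_dvd_of_dvd hdb))
      ((hba.coprime_dvd_left hdb).coprime_dvd_right (Nat.totient_dvd_of_dvd hda)) rfl
    rw [← commutatorElement_eq_one_iff_commute, ← map_commutatorElement,
      QuotientGroup.mk'_apply, QuotientGroup.eq_one_iff, Subgroup.mem_center_iff] at hq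
    exact h (commute_of_commute_commutator hG (hq a) (hq b) fun p hp hpa hpb =>
      ⟨not_sq_dvd_of_coprime_totient hp hba hpb, not_sq_dvd_of_coprime_totient hp hab hpa⟩)

theorem exists_bicyclic_not_commute {m n p : ℕ} (hm : 0 < m) (hn : 0 < n) (hp : p.Prime)
    (hpm : p ∣ m) (hpn : p ∣ n.totient) :
    ∃ (G : Type) (_ : Group G) (_ : Finite G) (a b : G), orderOf a = m ∧ orderOf b = n ∧
      (∀ g : G, ∃ i j : ℤ, g = a ^ i * b ^ j) ∧ ¬ Commute a b := by
  have : Fact p.Prime := ⟨hp⟩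
  have : NeZero m := ⟨hm.ne'⟩
  have : NeZero n := ⟨hn.ne'⟩
  obtain ⟨σ, hσ⟩ : ∃ σ : MulAut (Multiplicative (ZMod n)), orderOf σ = p := by
    apply exists_prime_orderOf_dvd_card' p
    rw [IsCyclic.card_mulAut]
    simpa using hpn
  have hσm : σ ^ m = 1 := by rw [← orderOf_dvd_iff_pow_eq_one, hσ]; exact hpm
  let f : Multiplicative (ZMod m) →* MulAut (Multiplicative (ZMod n)) :=
    (ZMod.lift m ⟨zmultiplesHom (Additive (MulAut (Multiplicative (ZMod n)))) (Additive.ofMul σ), by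
      simp [← ofMul_pow, hσm]⟩).toMultiplicativeLeft
  have hf : f (Multiplicative.ofAdd 1) = σ := by
    have := ZMod.lift_coe m ⟨zmultiplesHom (Additive (MulAut (Multiplicative (ZMod n))))
      (Additive.ofMul σ), by simp [← ofMul_pow, hσm]⟩ 1
    simp only [Int.cast_one] at this
    simp [f, this]
  have gen : ∀ (k : ℕ) [NeZero k] (x : Multiplicative (ZMod k)),
      ∃ i : ℤ, x = Multiplicative.ofAdd 1 ^ i := by
    intro k _ x
    refine ⟨(x.toAdd).val, ?_⟩
    rw [← ofAdd_zsmul]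
    simp
  refine ⟨Multiplicative (ZMod n) ⋊[f] Multiplicative (ZMod m), inferInstance,
    Finite.of_equiv _ SemidirectProduct.equivProd.symm,
    SemidirectProduct.inr (Multiplicative.ofAdd 1), SemidirectProduct.inl (Multiplicative.ofAdd 1),
    ?_, ?_, ?_, ?_⟩
  · rw [orderOf_injective _ SemidirectProduct.inr_injective, orderOf_ofAdd_eq_addOrderOf,
      ZMod.addOrderOf_one]
  · rw [orderOf_injective _ SemidirectProduct.inl_injective, orderOf_ofAdd_eq_addOrderOf,
      ZMod.addOrderOf_one]
  · refine exists_eq_mul_swap fun g => ?_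
    obtain ⟨i, hi⟩ := gen m g.right
    obtain ⟨j, hj⟩ := gen n g.left
    refine ⟨j, i, ?_⟩
    rw [← map_zpow SemidirectProduct.inl, ← map_zpow SemidirectProduct.inr, ← hi, ← hj,
      SemidirectProduct.inl_left_mul_inr_right]
  · intro h
    have h1 : σ (Multiplicative.ofAdd 1) = Multiplicative.ofAdd 1 := by
      apply SemidirectProduct.inl_injective (φ := f)
      rw [← hf, SemidirectProduct.inl_aut, h.eq, map_inv, mul_inv_cancel_right]
    have h2 : σ = 1 := by
      ext x
      obtain ⟨i, rfl⟩ := gen n x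
      rw [map_zpow, h1, MulAut.one_apply]
    rw [h2, orderOf_one] at hσ
    exact hp.one_lt.ne hσ


/-- Every finite group expressible as a product of a cyclic subgroup of order `m` and a
cyclic subgroup of order `n` is abelian if and only if
`gcd(m, φ(n)) = gcd(n, φ(m)) = 1`. -/
theorem bicyclic_abelian_iff_singular (m n : ℕ) (hm : 0 < m) (hn : 0 < n) :
    (∀ (G : Type) (_ : Group G) (_ : Finite G) (a b : G),
        orderOf a = m → orderOf b = n →
        (∀ g : G, ∃ i j : ℤ, g = a ^ i * b ^ j) →
        ∀ x y : G, x * y = y * x) ↔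
      Nat.gcd m (Nat.totient n) = 1 ∧ Nat.gcd n (Nat.totient m) = 1 := by
  constructor
  · intro H
    constructor
    · by_contra hne
      obtain ⟨p, hp, hpm, hpn⟩ := Nat.Prime.not_coprime_iff_dvd.mp hne
      obtain ⟨G, hG, hfin, a, b, ha, hb, hgen, hab⟩ :=
        exists_bicyclic_not_commute hm hn hp hpm hpn
      exact hab (H G hG hfin a b ha hb hgen a b)
    · by_contra hne
      obtain ⟨p, hp, hpn, hpm⟩ := Nat.Prime.not_coprime_iff_dvd.mp hne
      obtain ⟨G, hG, hfin, b, a, hb, ha, hgen, hba⟩ :=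
        exists_bicyclic_not_commute hn hm hp hpn hpm
      exact hba (H G hG hfin a b ha hb (exists_eq_mul_swap hgen) b a)
  · rintro ⟨h1, h2⟩ G hG hfin a b rfl rfl hgen x y
    have hab : Commute a b := commute_of_coprime_totient hgen h1 h2
    obtain ⟨i, j, rfl⟩ := hgen x
    obtain ⟨k, l, rfl⟩ := hgen y
    exact (((Commute.refl a).zpow_zpow i k).mul_right (hab.zpow_zpow i l)).mul_left
      ((hab.symm.zpow_zpow j k).mul_right ((Commute.refl b).zpow_zpow j l))
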